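/- Let n ∈ ℕ, let G = (G_1, …, G_n) be a vector of independent standard real Gaussian random variables, let A be a real n×n matrix, and set X = A·G (so X is centered Gaussian with covariance Σ = A·Aᵀ). Let h : ℝⁿ → ℝ be continuously differentiable with |h| and |∇h| bounded by a polynomial. Then E[X_1 · h(X)] = Σ_{i=1}^{n} Σ_{1i} · E[ (∂h/∂x_i)(X) ], where Σ_{1i} = (A·Aᵀ)_{1i} = E[X_1 · X_i]. (Multivariate Stein's lemma.) -/

import Mathlib

open Real MeasureTheory Matrix

/-- Standard Gaussian probability density function. -/
noncomputable def gpdf (x : ℝ) : ℝ := (Real.sqrt (2 * Real.pi))⁻¹ * Real.exp (-(x ^ 2) / 2)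

lemma hasDerivAt_gpdf (x : ℝ) : HasDerivAt gpdf (-x * gpdf x) x := by
  have h1 : HasDerivAt (fun y : ℝ => -(y ^ 2) / 2) (-x) x := by
    refine ((hasDerivAt_pow 2 x).fun_neg.div_const 2).congr_deriv ?_
    norm_num
    ring
  refine (h1.exp.const_mul (Real.sqrt (2 * Real.pi))⁻¹).congr_deriv ?_
  rw [gpdf]
  ring

lemma gpdf_nonneg (x : ℝ) : 0 ≤ gpdf x := by
  unfold gpdf
  positivity

lemma continuous_gpdf : Continuous gpdf :=
  continuous_iff_continuousAt.2 fun x => (hasDerivAt_gpdf x).continuousAt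

lemma integrable_one_add_abs_pow_mul_gpdf (k : ℕ) :
    Integrable fun x : ℝ => (1 + |x|) ^ k * gpdf x := by
  refine ((integrable_exp_neg_mul_sq (b := 1 / 4) (by norm_num)).const_mul
    ((k.factorial : ℝ) * (Real.sqrt (2 * Real.pi))⁻¹ * Real.exp 2)).mono'
    ((by fun_prop : Continuous fun x : ℝ => (1 + |x|) ^ k).mul
      continuous_gpdf).aestronglyMeasurable (.of_forall fun x => ?_)
  have hpow : (1 + |x|) ^ k ≤ k.factorial * Real.exp (1 + |x|) := by
    have := Real.pow_div_factorial_le_exp (1 + |x|) (by positivity) k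
    rwa [div_le_iff₀' (by positivity)] at this
  have hexp : Real.exp (1 + |x|) * Real.exp (-(x ^ 2) / 2) ≤
      Real.exp 2 * Real.exp (-(1 / 4) * x ^ 2) := by
    rw [← Real.exp_add, ← Real.exp_add, Real.exp_le_exp]
    nlinarith [sq_nonneg (|x| - 2), sq_abs x]
  rw [Real.norm_of_nonneg (mul_nonneg (by positivity) (gpdf_nonneg x))]
  calc (1 + |x|) ^ k * gpdf x
      ≤ k.factorial * Real.exp (1 + |x|) * gpdf x :=
        mul_le_mul_of_nonneg_right hpow (gpdf_nonneg x)
    _ = k.factorial * (Real.sqrt (2 * Real.pi))⁻¹ *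
        (Real.exp (1 + |x|) * Real.exp (-(x ^ 2) / 2)) := by
        rw [gpdf]
        ring
    _ ≤ k.factorial * (Real.sqrt (2 * Real.pi))⁻¹ *
        (Real.exp 2 * Real.exp (-(1 / 4) * x ^ 2)) := by gcongr
    _ = _ := by ring

section StandardGaussian

variable {ι : Type*} [Fintype ι]

lemma continuous_prod_gpdf : Continuous fun g : ι → ℝ => ∏ i, gpdf (g i) :=
  continuous_finsetProd _ fun i _ => continuous_gpdf.comp (continuous_apply i)

lemma one_add_norm_le_prod (g : ι → ℝ) : 1 + ‖g‖ ≤ ∏ i, (1 + |g i|) := by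
  have hone : ∀ i, 1 ≤ 1 + |g i| := fun i => by simp
  have hnorm : ‖g‖ ≤ ∏ i, (1 + |g i|) - 1 := by
    refine (pi_norm_le_iff_of_nonneg (sub_nonneg.2 (Finset.one_le_prod fun i _ => hone i))).2
      fun i => ?_
    have := Finset.prod_le_prod_of_subset_of_one_le (Finset.subset_univ {i})
      (fun j _ => zero_le_one.trans (hone j)) fun j _ _ => hone j
    rw [Finset.prod_singleton] at this
    rw [Real.norm_eq_abs]
    linarith
  linarith

lemma integrable_mul_prod_gpdf {f : (ι → ℝ) → ℝ} (hf : Continuous f) (C : ℝ) (k : ℕ)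
    (hbound : ∀ g, |f g| ≤ C * (1 + ‖g‖) ^ k) :
    Integrable fun g : ι → ℝ => f g * ∏ i, gpdf (g i) := by
  have hC : 0 ≤ C := by simpa using (abs_nonneg _).trans (hbound 0)
  refine ((Integrable.fintype_prod (f := fun (_ : ι) (x : ℝ) => (1 + |x|) ^ k * gpdf x)
    fun _ => integrable_one_add_abs_pow_mul_gpdf k).const_mul C).mono'
    (hf.mul continuous_prod_gpdf).aestronglyMeasurable (.of_forall fun g => ?_)
  have hprod : 0 ≤ ∏ i, gpdf (g i) := Finset.prod_nonneg fun i _ => gpdf_nonneg _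
  rw [norm_mul, Real.norm_eq_abs, Real.norm_of_nonneg hprod, Finset.prod_mul_distrib,
    Finset.prod_pow, ← mul_assoc]
  refine mul_le_mul_of_nonneg_right ((hbound g).trans ?_) hprod
  gcongr
  exact one_add_norm_le_prod g

lemma hasFDerivAt_prod_gpdf (g : ι → ℝ) :
    HasFDerivAt (fun g : ι → ℝ => ∏ i, gpdf (g i))
      (-(∏ i, gpdf (g i)) • ∑ i, g i • ContinuousLinearMap.proj (R := ℝ) i) g := by
  classical
  have hcoord : ∀ i ∈ Finset.univ, HasFDerivAt (fun g : ι → ℝ => gpdf (g i))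
      ((-g i * gpdf (g i)) • ContinuousLinearMap.proj (R := ℝ) i) g := fun i _ =>
    (hasDerivAt_gpdf (g i)).comp_hasFDerivAt (h₂ := gpdf) (f := fun g : ι → ℝ => g i) g
      (hasFDerivAt_apply i g)
  refine (HasFDerivAt.finsetProd hcoord).congr_fderiv (Eq.symm ?_)
  rw [Finset.smul_sum]
  refine Finset.sum_congr rfl fun i hi => ?_
  rw [smul_smul, smul_smul, ← Finset.prod_erase_mul _ _ hi]
  congr 1
  ring

/-- Gaussian integration by parts in the direction `v`. -/
lemma integral_dotProduct_mul_prod_gpdf {f : (ι → ℝ) → ℝ} (hf : ContDiff ℝ 1 f)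
    {C : ℝ} {k : ℕ} (hbound : ∀ g, |f g| ≤ C * (1 + ‖g‖) ^ k)
    (hbound' : ∀ g, ‖fderiv ℝ f g‖ ≤ C * (1 + ‖g‖) ^ k) (v : ι → ℝ) :
    ∫ g : ι → ℝ, (v ⬝ᵥ g) * f g * ∏ i, gpdf (g i) =
      ∫ g : ι → ℝ, fderiv ℝ f g v * ∏ i, gpdf (g i) := by
  have hC : 0 ≤ C := by simpa using (abs_nonneg _).trans (hbound 0)
  have hderiv : ∀ g : ι → ℝ, fderiv ℝ (fun g : ι → ℝ => ∏ i, gpdf (g i)) g v =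
      -((v ⬝ᵥ g) * ∏ i, gpdf (g i)) := fun g => by
    rw [(hasFDerivAt_prod_gpdf g).fderiv]
    simp [dotProduct, mul_comm]
  have hdot : ∀ g : ι → ℝ, |v ⬝ᵥ g| ≤ (∑ i, |v i|) * (1 + ‖g‖) := fun g => by
    rw [dotProduct, Finset.sum_mul]
    refine (Finset.abs_sum_le_sum_abs _ _).trans (Finset.sum_le_sum fun i _ => ?_)
    rw [abs_mul]
    have : |g i| ≤ ‖g‖ := norm_le_pi_norm g i
    gcongr
    linarith
  have hdotf : Integrable fun g : ι → ℝ => (v ⬝ᵥ g) * f g * ∏ i, gpdf (g i) := by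
    refine integrable_mul_prod_gpdf (.mul (by unfold dotProduct; fun_prop) hf.continuous)
      ((∑ i, |v i|) * C) (k + 1) fun g => ?_
    rw [abs_mul]
    calc |v ⬝ᵥ g| * |f g| ≤ ((∑ i, |v i|) * (1 + ‖g‖)) * (C * (1 + ‖g‖) ^ k) :=
          mul_le_mul (hdot g) (hbound g) (abs_nonneg _) (by positivity)
      _ = _ := by ring
  have hfderiv : Integrable fun g : ι → ℝ => fderiv ℝ f g v * ∏ i, gpdf (g i) := by
    refine integrable_mul_prod_gpdf ((hf.continuous_fderiv one_ne_zero).clm_apply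
      continuous_const) (C * ‖v‖) k fun g => ?_
    calc |fderiv ℝ f g v| ≤ ‖fderiv ℝ f g‖ * ‖v‖ := (fderiv ℝ f g).le_opNorm v
      _ ≤ C * (1 + ‖g‖) ^ k * ‖v‖ := by gcongr; exact hbound' g
      _ = _ := by ring
  have hswap : ∀ g : ι → ℝ, f g * fderiv ℝ (fun g : ι → ℝ => ∏ i, gpdf (g i)) g v =
      -((v ⬝ᵥ g) * f g * ∏ i, gpdf (g i)) := fun g => by
    rw [hderiv]
    ring
  have hparts := integral_mul_fderiv_eq_neg_fderiv_mul_of_integrable (μ := volume) (v := v)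
    hfderiv (by simpa only [hswap] using hdotf.fun_neg)
    (integrable_mul_prod_gpdf hf.continuous C k hbound)
    (fun g _ => hf.differentiable one_ne_zero g)
    (fun g _ => (hasFDerivAt_prod_gpdf g).differentiableAt)
  simpa only [hswap, integral_neg, neg_inj] using hparts

end StandardGaussian

/-- Multivariate Stein's lemma.  Let `G = (G₁, …, Gₙ)` be a vector of independent
standard Gaussians (expectation realised as an integral against the product density
`∏ i, gpdf (g i)`), let `A` be a real `n×n` matrix and `X = A·G` (centered Gaussian with
covariance `Σ = A·Aᵀ`).  For `h` continuously differentiable with `|h|` and `‖∇h‖`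
polynomially bounded,
`E[X₁·h(X)] = ∑ i, Σ₁ᵢ·E[(∂h/∂xᵢ)(X)]`. -/
theorem multivariate_stein (n : ℕ) [NeZero n] (A : Matrix (Fin n) (Fin n) ℝ)
    (h : (Fin n → ℝ) → ℝ) (hh : ContDiff ℝ 1 h)
    (c : ℝ) (hc : 0 < c) (m : ℕ)
    (hb : ∀ x : Fin n → ℝ, |h x| ≤ c * (1 + ‖x‖) ^ m)
    (hb' : ∀ x : Fin n → ℝ, ‖fderiv ℝ h x‖ ≤ c * (1 + ‖x‖) ^ m) :
    (∫ g : Fin n → ℝ, (A *ᵥ g) 0 * h (A *ᵥ g) * ∏ i, gpdf (g i))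
    = ∑ i : Fin n, (A * Aᵀ) 0 i *
        ∫ g : Fin n → ℝ, fderiv ℝ h (A *ᵥ g) (Pi.single i 1) * ∏ i, gpdf (g i) := by
  let L : (Fin n → ℝ) →L[ℝ] (Fin n → ℝ) := A.mulVecLin.toContinuousLinearMap
  have hL : ∀ g, L g = A *ᵥ g := fun _ => rfl
  have hcomp : ∀ g, HasFDerivAt (fun g => h (A *ᵥ g)) ((fderiv ℝ h (A *ᵥ g)).comp L) g :=
    fun g => ((hh.differentiable one_ne_zero (L g)).hasFDerivAt).comp g L.hasFDerivAt
  have hgrowth : ∀ g, c * (1 + ‖A *ᵥ g‖) ^ m ≤ c * (1 + ‖L‖) ^ m * (1 + ‖g‖) ^ m := fun g => by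
    rw [mul_assoc, ← mul_pow]
    gcongr
    have := L.le_opNorm g
    rw [hL] at this
    nlinarith [norm_nonneg L, norm_nonneg g]
  have hbase : ∀ g : Fin n → ℝ, 0 ≤ c * (1 + ‖L‖) ^ m * (1 + ‖g‖) ^ m :=
    fun g => by positivity
  have hparts := integral_dotProduct_mul_prod_gpdf (f := fun g => h (A *ᵥ g))
    (C := c * (1 + ‖L‖) ^ m * (1 + ‖L‖)) (k := m) (hh.comp L.contDiff)
    (fun g => by
      nlinarith [(hb (A *ᵥ g)).trans (hgrowth g), mul_nonneg (hbase g) (norm_nonneg L)])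
    (fun g => by
      rw [(hcomp g).fderiv]
      calc ‖(fderiv ℝ h (A *ᵥ g)).comp L‖ ≤ ‖fderiv ℝ h (A *ᵥ g)‖ * ‖L‖ :=
            ContinuousLinearMap.opNorm_comp_le _ _
        _ ≤ c * (1 + ‖L‖) ^ m * (1 + ‖g‖) ^ m * (1 + ‖L‖) :=
            mul_le_mul ((hb' _).trans (hgrowth g)) (by linarith) (norm_nonneg _) (hbase g)
        _ = _ := by ring)
    (A 0)
  refine hparts.trans ?_
  have hrow : L (A 0) = ∑ i, (A * Aᵀ) 0 i • Pi.single i (1 : ℝ) := by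
    rw [← pi_eq_sum_univ']
    ext i
    simp [hL, mulVec, dotProduct, Matrix.mul_apply, mul_comm]
  have hint : ∀ i, Integrable fun g : Fin n → ℝ =>
      fderiv ℝ h (A *ᵥ g) (Pi.single i 1) * ∏ i, gpdf (g i) := fun i => by
    refine integrable_mul_prod_gpdf (((hh.continuous_fderiv one_ne_zero).comp
      L.continuous).clm_apply continuous_const) (c * (1 + ‖L‖) ^ m) m fun g => ?_
    have := (fderiv ℝ h (A *ᵥ g)).le_opNorm (Pi.single i 1)
    rw [Pi.norm_single, norm_one, mul_one] at this
    exact this.trans ((hb' _).trans (hgrowth g))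
  simp_rw [← integral_const_mul]
  rw [← integral_finsetSum _ fun i _ => (hint i).const_mul _]
  refine integral_congr_ae (.of_forall fun g => ?_)
  simp only [(hcomp g).fderiv, ContinuousLinearMap.comp_apply, hrow, map_sum, map_smul,
    smul_eq_mul, Finset.sum_mul, mul_assoc]
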